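/- arXiv:2404.11880 — 3 statements merged into one kernel-verified Lean document; each statement's English description precedes it below -/
import Mathlib

section
/- Assume S_U ⊆ (1, ∞) and S_L ⊆ (1, ∞). Then Σ_{j=1}^k w_j Φ(f(A_j)) ≤ ( max_{x ∈ S_U} x/log x )·log(B_U), and Σ_{j=1}^k w_j Φ(f(A_j)) ≥ ( min_{x ∈ S_L} x/log x )·log(B_L), in the Loewner order, where log is applied to B_U and B_L via continuous functional calculus. -/
open ContinuousLinearMap in
/-- The Kantorovich constant `K(m', M', r)`, with the convention that it equals `1`
for `r = 0` and `r = 1`. -/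
noncomputable def kantorovich (m M r : ℝ) : ℝ :=
  if r = 0 ∨ r = 1 then 1 else
    ((m * M ^ r - M * m ^ r) / ((r - 1) * (M - m))) *
      (((r - 1) * (M ^ r - m ^ r)) / (r * (m * M ^ r - M * m ^ r))) ^ r

open ContinuousLinearMap Polynomial

/-- For natural exponents the Kantorovich constant is at least one. -/
lemma one_le_kantorovich_natCast {m M : ℝ} (hm : 0 < m) (hmM : m < M) (n : ℕ) :
    1 ≤ kantorovich m M (n : ℝ) := by
  unfold kantorovich
  split_ifs with h
  · exact le_rfl
  have h0 : n ≠ 0 := fun h0 => h (Or.inl (by simp [h0]))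
  have h1 : n ≠ 1 := fun h1 => h (Or.inr (by simp [h1]))
  obtain ⟨p, rfl⟩ : ∃ p, n = p + 2 := ⟨n - 2, by omega⟩
  simp only [Real.rpow_natCast]
  have hM : 0 < M := hm.trans hmM
  have hpow : m ^ (p + 1) < M ^ (p + 1) := pow_lt_pow_left₀ hmM hm.le (by omega)
  have hpow' : m ^ (p + 2) < M ^ (p + 2) := pow_lt_pow_left₀ hmM hm.le (by omega)
  have hb : 0 < m * M ^ (p + 2) - M * m ^ (p + 2) := by
    have : m * M ^ (p + 2) - M * m ^ (p + 2) = m * M * (M ^ (p + 1) - m ^ (p + 1)) := by ring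
    rw [this]
    exact mul_pos (mul_pos hm hM) (sub_pos.2 hpow)
  have hn : (0 : ℝ) < ((p + 2 : ℕ) : ℝ) - 1 := by
    push_cast
    have : (0 : ℝ) ≤ p := p.cast_nonneg
    linarith
  have hd : 0 < M - m := sub_pos.2 hmM
  have hc : 0 < M ^ (p + 2) - m ^ (p + 2) := sub_pos.2 hpow'
  set r : ℝ := ((p + 2 : ℕ) : ℝ) with hr
  have hr0 : 0 < r := by linarith
  set b := m * M ^ (p + 2) - M * m ^ (p + 2) with hb_def
  set c := M ^ (p + 2) - m ^ (p + 2) with hc_def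
  have ht : 0 < (r - 1) * c / (r * b) := by positivity
  have bern := one_add_mul_sub_le_pow (a := M * ((r - 1) * c / (r * b)))
    (by have := mul_pos hM ht; linarith) (p + 2)
  rw [← hr, mul_pow] at bern
  have hkey : b / ((r - 1) * (M - m)) * (1 + r * (M * ((r - 1) * c / (r * b)) - 1))
      = M ^ (p + 2) := by
    have e : b / ((r - 1) * (M - m)) * (1 + r * (M * ((r - 1) * c / (r * b)) - 1))
      = (M * c - b) / (M - m) := by
      field_simp
      ring
    rw [e, div_eq_iff hd.ne', hb_def, hc_def]
    ring
  have hle := mul_le_mul_of_nonneg_left bern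
    (show 0 ≤ b / ((r - 1) * (M - m)) by positivity)
  rw [hkey] at hle
  have hMp : 0 < M ^ (p + 2) := by positivity
  refine le_of_mul_le_mul_left ?_ hMp
  calc M ^ (p + 2) * 1 = M ^ (p + 2) := mul_one _
    _ ≤ _ := hle
    _ = _ := by ring

/-- The convex hull of a bounded real set has compact closure. -/
lemma isCompact_closure_convexHull_real {s : Set ℝ} (hs : Bornology.IsBounded s) :
    IsCompact (closure (convexHull ℝ s)) :=
  ((isBounded_convexHull.2 hs).closure).isCompact_closure.of_isClosed_subset isClosed_closure
    subset_closure

section Operators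

variable {H K : Type*} [NormedAddCommGroup H] [InnerProductSpace ℂ H] [CompleteSpace H]
  [NormedAddCommGroup K] [InnerProductSpace ℂ K] [CompleteSpace K]

lemma sum_smul_cfc_pow {A : H →L[ℂ] H} (hA : IsSelfAdjoint A) {f : ℝ → ℝ}
    (hf : ContinuousOn f (spectrum ℝ A)) (a : ℕ → ℝ) (s : Finset ℕ) :
    ∑ i ∈ s, a i • (cfc f A) ^ i = cfc (fun x => ∑ i ∈ s, a i * f x ^ i) A := by
  have h := cfc_sum (fun i x => a i * f x ^ i) A s (fun i _ => by fun_prop)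
  have e : (∑ i ∈ s, fun x => a i * f x ^ i) = fun x => ∑ i ∈ s, a i * f x ^ i := by
    ext x
    simp
  rw [e] at h
  rw [h]
  refine Finset.sum_congr rfl fun i _ => ?_
  rw [cfc_const_mul (a i) (fun x => f x ^ i) A (by fun_prop), cfc_pow f i A hf]

lemma adjoint_conj_mono (V : K →L[ℂ] H) {S T : H →L[ℂ] H} (h : S ≤ T) :
    (adjoint V) ∘L S ∘L V ≤ (adjoint V) ∘L T ∘L V := by
  rw [ContinuousLinearMap.le_def] at h ⊢
  have := h.adjoint_conj V
  simpa only [ContinuousLinearMap.sub_comp, ContinuousLinearMap.comp_sub] using this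

lemma sum_smul_adjoint_conj_mono {k : ℕ} (V : K →L[ℂ] H) {w : Fin k → ℝ} (hw : ∀ j, 0 ≤ w j)
    {S T : Fin k → H →L[ℂ] H} (h : ∀ j, S j ≤ T j) :
    ∑ j, w j • ((adjoint V) ∘L S j ∘L V) ≤ ∑ j, w j • ((adjoint V) ∘L T j ∘L V) :=
  Finset.sum_le_sum fun j _ => smul_le_smul_of_nonneg_left (adjoint_conj_mono V (h j)) (hw j)

lemma sum_smul_adjoint_conj_algebraMap {k : ℕ} {V : K →L[ℂ] H} (hV : (adjoint V) ∘L V = 1)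
    {w : Fin k → ℝ} (hw1 : ∑ j, w j = 1) (c : ℝ) :
    ∑ j, w j • ((adjoint V) ∘L (algebraMap ℝ (H →L[ℂ] H) c) ∘L V)
      = algebraMap ℝ (K →L[ℂ] K) c := by
  have e : (adjoint V) ∘L (algebraMap ℝ (H →L[ℂ] H) c) ∘L V = c • (1 : K →L[ℂ] K) := by
    rw [Algebra.algebraMap_eq_smul_one, ← hV]
    ext x
    simp
  rw [e, ← Finset.sum_smul, hw1, one_smul, Algebra.algebraMap_eq_smul_one]

/-- The spectrum of a weighted sum of compressions lies in any closed convex set containing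
the ranges of the functions involved. -/
lemma spectrum_sum_smul_adjoint_conj_cfc_subset {k : ℕ} {V : K →L[ℂ] H}
    (hV : (adjoint V) ∘L V = 1) {w : Fin k → ℝ} (hw : ∀ j, 0 ≤ w j) (hw1 : ∑ j, w j = 1)
    {A : Fin k → H →L[ℂ] H} (hA : ∀ j, IsSelfAdjoint (A j)) {q : Fin k → ℝ → ℝ}
    (hq : ∀ j, ContinuousOn (q j) (spectrum ℝ (A j))) {S : Set ℝ} (hS : IsCompact S)
    (hconv : Convex ℝ S) (hne : S.Nonempty)
    (hqS : ∀ j, ∀ x ∈ spectrum ℝ (A j), q j x ∈ S) :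
    IsSelfAdjoint (∑ j, w j • ((adjoint V) ∘L (cfc (q j) (A j)) ∘L V)) ∧
    spectrum ℝ (∑ j, w j • ((adjoint V) ∘L (cfc (q j) (A j)) ∘L V)) ⊆ S := by
  have hlo : algebraMap ℝ (K →L[ℂ] K) (sInf S)
      ≤ ∑ j, w j • ((adjoint V) ∘L (cfc (q j) (A j)) ∘L V) := by
    rw [← sum_smul_adjoint_conj_algebraMap hV hw1]
    exact sum_smul_adjoint_conj_mono V hw fun j =>
      algebraMap_le_cfc (q j) _ (A j) (fun x hx => csInf_le hS.bddBelow (hqS j x hx))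
        (hq j) (hA j)
  have hhi : ∑ j, w j • ((adjoint V) ∘L (cfc (q j) (A j)) ∘L V)
      ≤ algebraMap ℝ (K →L[ℂ] K) (sSup S) := by
    rw [← sum_smul_adjoint_conj_algebraMap hV hw1]
    exact sum_smul_adjoint_conj_mono V hw fun j =>
      cfc_le_algebraMap (q j) _ (A j) (fun x hx => le_csSup hS.bddAbove (hqS j x hx))
        (hq j) (hA j)
  have hsa : IsSelfAdjoint (∑ j, w j • ((adjoint V) ∘L (cfc (q j) (A j)) ∘L V)) := by
    have h1 : IsSelfAdjoint (algebraMap ℝ (K →L[ℂ] K) (sInf S)) := .algebraMap _ (.all _)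
    have h2 := (IsSelfAdjoint.of_nonneg (sub_nonneg.2 hlo)).add h1
    rwa [sub_add_cancel] at h2
  refine ⟨hsa, fun x hx => ?_⟩
  have h1 := (algebraMap_le_iff_le_spectrum hsa).1 hlo x hx
  have h2 := (le_algebraMap_iff_spectrum_le hsa).1 hhi x hx
  exact hconv.ordConnected.out (hS.sInf_mem hne) (hS.sSup_mem hne) ⟨h1, h2⟩

lemma le_sSup_smul_cfc_log {B : K →L[ℂ] K} (hB : IsSelfAdjoint B) {S : Set ℝ}
    (hS : IsCompact S) (hS1 : S ⊆ Set.Ioi 1) (hBS : spectrum ℝ B ⊆ S) :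
    B ≤ (sSup ((fun x => x / Real.log x) '' S)) • cfc Real.log B := by
  have hlog : ContinuousOn Real.log S := Real.continuousOn_log.mono fun x hx =>
    (zero_lt_one.trans (hS1 hx)).ne'
  have hbdd : BddAbove ((fun x => x / Real.log x) '' S) :=
    (hS.image_of_continuousOn (continuousOn_id.div hlog fun x hx =>
      (Real.log_pos (hS1 hx)).ne')).bddAbove
  have hlogB := hlog.mono hBS
  rw [← cfc_const_mul _ Real.log B hlogB]
  conv_lhs => rw [← cfc_id ℝ B hB]
  refine cfc_mono (fun x hx => ?_) continuousOn_id (continuousOn_const.mul hlogB)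
  exact (div_le_iff₀ (Real.log_pos (hS1 (hBS hx)))).1 (le_csSup hbdd ⟨x, hBS hx, rfl⟩)

lemma sInf_smul_cfc_log_le {B : K →L[ℂ] K} (hB : IsSelfAdjoint B) {S : Set ℝ}
    (hS : IsCompact S) (hS1 : S ⊆ Set.Ioi 1) (hBS : spectrum ℝ B ⊆ S) :
    (sInf ((fun x => x / Real.log x) '' S)) • cfc Real.log B ≤ B := by
  have hlog : ContinuousOn Real.log S := Real.continuousOn_log.mono fun x hx =>
    (zero_lt_one.trans (hS1 hx)).ne'
  have hbdd : BddBelow ((fun x => x / Real.log x) '' S) :=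
    (hS.image_of_continuousOn (continuousOn_id.div hlog fun x hx =>
      (Real.log_pos (hS1 hx)).ne')).bddBelow
  have hlogB := hlog.mono hBS
  rw [← cfc_const_mul _ Real.log B hlogB]
  conv_rhs => rw [← cfc_id ℝ B hB]
  refine cfc_mono (fun x hx => ?_) (continuousOn_const.mul hlogB) continuousOn_id
  exact (le_div_iff₀ (Real.log_pos (hS1 (hBS hx)))).1 (csInf_le hbdd ⟨x, hBS hx, rfl⟩)

end Operators

lemma sum_mul_pow_le_of_bounds (s : Finset ℕ) (a c d : ℕ → ℝ) {l y u : ℝ} (hl : 0 ≤ l)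
    (hly : l ≤ y) (hyu : y ≤ u) (hc : ∀ i, 1 ≤ c i) (hd : ∀ i, 1 ≤ d i) :
    ∑ i ∈ s, a i * y ^ i ≤ ∑ i ∈ s with 0 ≤ a i, a i * c i * u ^ i +
      ∑ i ∈ s with a i < 0, a i * (d i)⁻¹ * l ^ i := by
  rw [← Finset.sum_filter_add_sum_filter_not s (fun i => 0 ≤ a i)]
  simp only [not_le]
  refine add_le_add (Finset.sum_le_sum fun i hi => ?_) (Finset.sum_le_sum fun i hi => ?_)
  · rw [mul_assoc]
    refine mul_le_mul_of_nonneg_left ?_ (Finset.mem_filter.1 hi).2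
    exact (pow_le_pow_left₀ (hl.trans hly) hyu i).trans
      (le_mul_of_one_le_left (pow_nonneg (hl.trans (hly.trans hyu)) i) (hc i))
  · rw [mul_assoc]
    refine mul_le_mul_of_nonpos_left ?_ (Finset.mem_filter.1 hi).2.le
    exact (mul_le_of_le_one_left (pow_nonneg hl i) (inv_le_one_of_one_le₀ (hd i))).trans
      (pow_le_pow_left₀ hl hly i)

lemma le_sum_mul_pow_of_bounds (s : Finset ℕ) (a c d : ℕ → ℝ) {l y u : ℝ} (hl : 0 ≤ l)
    (hly : l ≤ y) (hyu : y ≤ u) (hc : ∀ i, 1 ≤ c i) (hd : ∀ i, 1 ≤ d i) :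
    ∑ i ∈ s with 0 ≤ a i, a i * (d i)⁻¹ * l ^ i + ∑ i ∈ s with a i < 0, a i * c i * u ^ i ≤
      ∑ i ∈ s, a i * y ^ i := by
  rw [← Finset.sum_filter_add_sum_filter_not s (fun i => 0 ≤ a i) (fun i => a i * y ^ i)]
  simp only [not_le]
  refine add_le_add (Finset.sum_le_sum fun i hi => ?_) (Finset.sum_le_sum fun i hi => ?_)
  · rw [mul_assoc]
    refine mul_le_mul_of_nonneg_left ?_ (Finset.mem_filter.1 hi).2
    exact (mul_le_of_le_one_left (pow_nonneg hl i) (inv_le_one_of_one_le₀ (hd i))).trans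
      (pow_le_pow_left₀ hl hly i)
  · rw [mul_assoc]
    refine mul_le_mul_of_nonpos_left ?_ (Finset.mem_filter.1 hi).2.le
    exact (pow_le_pow_left₀ (hl.trans hly) hyu i).trans
      (le_mul_of_one_le_left (pow_nonneg (hl.trans (hly.trans hyu)) i) (hc i))

lemma sInf_image_eval_Icc_pos {p : ℝ[X]} {m M : ℝ} (hmM : m ≤ M)
    (hp : ∀ x ∈ Set.Icc m M, 0 < p.eval x) :
    0 < sInf ((fun x => p.eval x) '' Set.Icc m M) := by
  obtain ⟨x, hx, hxe⟩ := (isCompact_Icc.image p.continuous).sInf_mem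
    ((Set.nonempty_Icc.2 hmM).image (fun x => p.eval x))
  exact hxe ▸ hp x hx

lemma isBounded_iUnion_image_Icc {k : ℕ} {q : Fin k → ℝ → ℝ} (hq : ∀ j, Continuous (q j))
    (m M : Fin k → ℝ) : Bornology.IsBounded (⋃ j, q j '' Set.Icc (m j) (M j)) :=
  (isCompact_iUnion fun j => isCompact_Icc.image (hq j)).isBounded

theorem stmt11
    {H K : Type*} [NormedAddCommGroup H] [InnerProductSpace ℂ H] [CompleteSpace H]
    [NormedAddCommGroup K] [InnerProductSpace ℂ K] [CompleteSpace K]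
    (V : K →L[ℂ] H) (hV : (adjoint V) ∘L V = 1)
    (I : ℕ) (a : ℕ → ℝ)
    (k : ℕ) (hk : 1 ≤ k)
    (w : Fin k → ℝ) (hw : ∀ j, 0 ≤ w j) (hw1 : ∑ j, w j = 1)
    (m M : Fin k → ℝ) (hmM : ∀ j, m j < M j)
    (A : Fin k → H →L[ℂ] H) (hA : ∀ j, IsSelfAdjoint (A j))
    (hspec : ∀ j, spectrum ℝ (A j) ⊆ Set.Icc (m j) (M j))
    (f : ℝ → ℝ) (hf : ContinuousOn f (⋃ j, Set.Icc (m j) (M j)))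
    (pL pU : Polynomial ℝ)
    (hp : ∀ x ∈ ⋃ j, Set.Icc (m j) (M j),
      0 < pL.eval x ∧ pL.eval x ≤ f x ∧ f x ≤ pU.eval x)
    (mU MU mL ML : Fin k → ℝ)
    (hmU : ∀ j, mU j = sInf ((fun x => pU.eval x) '' Set.Icc (m j) (M j)))
    (hMU : ∀ j, MU j = sSup ((fun x => pU.eval x) '' Set.Icc (m j) (M j)))
    (hmL : ∀ j, mL j = sInf ((fun x => pL.eval x) '' Set.Icc (m j) (M j)))
    (hML : ∀ j, ML j = sSup ((fun x => pL.eval x) '' Set.Icc (m j) (M j)))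
    (hUlt : ∀ j, mU j < MU j) (hLlt : ∀ j, mL j < ML j)
    (qU qL : Fin k → ℝ → ℝ)
    (hqU : ∀ j x, qU j x =
      (∑ i ∈ (Finset.range (I + 1)).filter (fun i => 0 ≤ a i),
        a i * kantorovich (mU j) (MU j) (i : ℝ) * (pU.eval x) ^ i) +
      ∑ i ∈ (Finset.range (I + 1)).filter (fun i => a i < 0),
        a i * (kantorovich (mL j) (ML j) (i : ℝ))⁻¹ * (pL.eval x) ^ i)
    (hqL : ∀ j x, qL j x =
      (∑ i ∈ (Finset.range (I + 1)).filter (fun i => 0 ≤ a i),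
        a i * (kantorovich (mL j) (ML j) (i : ℝ))⁻¹ * (pL.eval x) ^ i) +
      ∑ i ∈ (Finset.range (I + 1)).filter (fun i => a i < 0),
        a i * kantorovich (mU j) (MU j) (i : ℝ) * (pU.eval x) ^ i)
    (BU BL : K →L[ℂ] K)
    (hBU : BU = ∑ j, w j • ((adjoint V) ∘L (cfc (qU j) (A j)) ∘L V))
    (hBL : BL = ∑ j, w j • ((adjoint V) ∘L (cfc (qL j) (A j)) ∘L V))
    (SU SL : Set ℝ)
    (hSU : SU = closure (convexHull ℝ (⋃ j, qU j '' Set.Icc (m j) (M j))))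
    (hSL : SL = closure (convexHull ℝ (⋃ j, qL j '' Set.Icc (m j) (M j))))
    (hSU1 : SU ⊆ Set.Ioi (1 : ℝ)) (hSL1 : SL ⊆ Set.Ioi (1 : ℝ)) :
    ((∑ j, w j • ((adjoint V) ∘L (∑ i ∈ Finset.range (I + 1), a i • (cfc f (A j)) ^ i) ∘L V)) ≤
      (sSup ((fun x => x / Real.log x) '' SU)) • cfc Real.log BU) ∧
    (sInf ((fun x => x / Real.log x) '' SL)) • cfc Real.log BL ≤
      (∑ j, w j • ((adjoint V) ∘L (∑ i ∈ Finset.range (I + 1), a i • (cfc f (A j)) ^ i) ∘L V)) := by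
  have hmem : ∀ j, ∀ x ∈ Set.Icc (m j) (M j), x ∈ ⋃ j, Set.Icc (m j) (M j) :=
    fun j x hx => Set.mem_iUnion.2 ⟨j, hx⟩
  have hKU : ∀ j (i : ℕ), 1 ≤ kantorovich (mU j) (MU j) (i : ℝ) := fun j i =>
    one_le_kantorovich_natCast (by
      rw [hmU]
      refine sInf_image_eval_Icc_pos (hmM j).le fun x hx => ?_
      obtain ⟨h1, h2, h3⟩ := hp x (hmem j x hx)
      linarith) (hUlt j) i
  have hKL : ∀ j (i : ℕ), 1 ≤ kantorovich (mL j) (ML j) (i : ℝ) := fun j i =>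
    one_le_kantorovich_natCast (by
      rw [hmL]
      exact sInf_image_eval_Icc_pos (hmM j).le fun x hx => (hp x (hmem j x hx)).1) (hLlt j) i
  have hqUc : ∀ j, Continuous (qU j) := fun j => by
    rw [funext (hqU j)]
    fun_prop
  have hqLc : ∀ j, Continuous (qL j) := fun j => by
    rw [funext (hqL j)]
    fun_prop
  have hfc : ∀ j, ContinuousOn f (spectrum ℝ (A j)) := fun j =>
    hf.mono fun x hx => hmem j x (hspec j hx)
  have hne : ∀ q : Fin k → ℝ → ℝ,
      (closure (convexHull ℝ (⋃ j, q j '' Set.Icc (m j) (M j)))).Nonempty := fun q =>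
    ⟨q ⟨0, hk⟩ (m ⟨0, hk⟩), subset_closure (subset_convexHull ℝ _ (Set.mem_iUnion.2
      ⟨⟨0, hk⟩, Set.mem_image_of_mem _ (Set.left_mem_Icc.2 (hmM _).le)⟩))⟩
  have hrange : ∀ q : Fin k → ℝ → ℝ, ∀ j, ∀ x ∈ spectrum ℝ (A j),
      q j x ∈ closure (convexHull ℝ (⋃ j, q j '' Set.Icc (m j) (M j))) := fun q j x hx =>
    subset_closure (subset_convexHull ℝ _ (Set.mem_iUnion.2
      ⟨j, Set.mem_image_of_mem _ (hspec j hx)⟩))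
  have hΦ : ∀ j, ∑ i ∈ Finset.range (I + 1), a i • (cfc f (A j)) ^ i =
      cfc (fun x => ∑ i ∈ Finset.range (I + 1), a i * f x ^ i) (A j) := fun j =>
    sum_smul_cfc_pow (hA j) (hfc j) a _
  have hgc : ∀ j, ContinuousOn (fun x => ∑ i ∈ Finset.range (I + 1), a i * f x ^ i)
      (spectrum ℝ (A j)) := fun j => by
    have := hfc j
    fun_prop
  constructor
  · have hcomp := isCompact_closure_convexHull_real (isBounded_iUnion_image_Icc hqUc m M)
    obtain ⟨hsa, hsub⟩ := spectrum_sum_smul_adjoint_conj_cfc_subset hV hw hw1 hA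
      (fun j => (hqUc j).continuousOn) hcomp (convex_convexHull ℝ _).closure (hne qU) (hrange qU)
    rw [← hBU] at hsa hsub
    rw [← hSU] at hcomp hsub
    refine le_trans ?_ (le_sSup_smul_cfc_log hsa hcomp hSU1 hsub)
    rw [hBU]
    refine sum_smul_adjoint_conj_mono V hw fun j => ?_
    rw [hΦ j]
    refine cfc_mono (fun x hx => ?_) (hgc j) (hqUc j).continuousOn
    obtain ⟨h1, h2, h3⟩ := hp x (hmem j x (hspec j hx))
    rw [hqU]
    exact sum_mul_pow_le_of_bounds _ a _ _ h1.le h2 h3 (hKU j) (hKL j)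
  · have hcomp := isCompact_closure_convexHull_real (isBounded_iUnion_image_Icc hqLc m M)
    obtain ⟨hsa, hsub⟩ := spectrum_sum_smul_adjoint_conj_cfc_subset hV hw hw1 hA
      (fun j => (hqLc j).continuousOn) hcomp (convex_convexHull ℝ _).closure (hne qL) (hrange qL)
    rw [← hBL] at hsa hsub
    rw [← hSL] at hcomp hsub
    refine le_trans (sInf_smul_cfc_log_le hsa hcomp hSL1 hsub) ?_
    rw [hBL]
    refine sum_smul_adjoint_conj_mono V hw fun j => ?_
    rw [hΦ j]
    refine cfc_mono (fun x hx => ?_) (hqLc j).continuousOn (hgc j)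
    obtain ⟨h1, h2, h3⟩ := hp x (hmem j x (hspec j hx))
    rw [hqL]
    exact le_sum_mul_pow_of_bounds _ a _ _ h1.le h2 h3 (hKU j) (hKL j)
end

section
/- It holds that Σ_{j=1}^k w_j Φ(f(A_j)) ≤ ( max_{x ∈ S_U} x·e^{−x} )·exp(B_U), and Σ_{j=1}^k w_j Φ(f(A_j)) ≥ ( min_{x ∈ S_L} x·e^{−x} )·exp(B_L), in the Loewner order, where exp is applied to B_U and B_L via continuous functional calculus. -/
open ContinuousLinearMap Polynomial

/-- A power lies above its tangent lines on the nonnegative half-line. -/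
theorem pow_add_mul_sub_le_pow {x y : ℝ} (hx : 0 ≤ x) (hy : 0 ≤ y) (n : ℕ) :
    x ^ (n + 1) + (n + 1) * x ^ n * (y - x) ≤ y ^ (n + 1) := by
  induction n with
  | zero => simp
  | succ n ih =>
    have h1 := mul_le_mul_of_nonneg_left ih hy
    have h2 : 0 ≤ ((n : ℝ) + 1) * x ^ n * (y - x) ^ 2 := by positivity
    push_cast
    calc _ = y * (x ^ (n + 1) + (n + 1) * x ^ n * (y - x)) - (n + 1) * x ^ n * (y - x) ^ 2 := by
          ring
      _ ≤ y ^ (n + 1 + 1) := by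
          rw [pow_succ' y (n + 1)]
          linarith

theorem one_le_kantorovich {m M : ℝ} (hm : 0 < m) (hM : m < M) (i : ℕ) :
    1 ≤ kantorovich m M i := by
  obtain _ | _ | n := i
  · simp [kantorovich]
  · simp [kantorovich]
  have hM0 : 0 < M := hm.trans hM
  have hd : 0 < M - m := sub_pos.2 hM
  have hn : (0 : ℝ) < n + 1 := by positivity
  have hr : ¬ (((n + 1 + 1 : ℕ) : ℝ) = 0 ∨ ((n + 1 + 1 : ℕ) : ℝ) = 1) := by
    push_cast
    rintro (h | h) <;> linarith
  rw [kantorovich, if_neg hr]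
  simp only [Real.rpow_natCast]
  push_cast
  rw [show (n : ℝ) + 1 + 1 - 1 = n + 1 by ring]
  set b := m * M ^ (n + 1 + 1) - M * m ^ (n + 1 + 1) with hb
  have htan {x y : ℝ} (hx : 0 ≤ x) (hy : 0 ≤ y) :
      x ^ (n + 1 + 1) + (n + 1 + 1) * x ^ (n + 1) * (y - x) ≤ y ^ (n + 1 + 1) := by
    simpa using pow_add_mul_sub_le_pow hx hy (n + 1)
  have hlow : m ^ (n + 1 + 1) ≤ b / ((n + 1) * (M - m)) := by
    rw [le_div_iff₀ (by positivity)]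
    have h := mul_le_mul_of_nonneg_left (htan hm.le hM0.le) hm.le
    rw [hb]
    ring_nf at h ⊢
    linarith
  have hupp : b / ((n + 1) * (M - m)) ≤ M ^ (n + 1 + 1) := by
    rw [div_le_iff₀ (by positivity)]
    have h := mul_le_mul_of_nonneg_left (htan hM0.le hm.le) hM0.le
    rw [hb]
    ring_nf at h ⊢
    linarith
  have hc0 : 0 < b / ((n + 1) * (M - m)) := lt_of_lt_of_le (by positivity) hlow
  obtain ⟨s, hs0, hs⟩ : ∃ s : ℝ, 0 < s ∧ s ^ (n + 1 + 1) = b / ((n + 1) * (M - m)) :=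
    ⟨_, Real.rpow_pos_of_pos hc0 _, Real.rpow_inv_natCast_pow hc0.le (by omega)⟩
  have hms : m ≤ s := by
    rw [← hs] at hlow
    exact le_of_pow_le_pow_left₀ (by omega) hs0.le hlow
  have hsM : s ≤ M := by
    rw [← hs] at hupp
    exact le_of_pow_le_pow_left₀ (by omega) hM0.le hupp
  have hbs : b = (n + 1) * (M - m) * s ^ (n + 1 + 1) := by
    rw [hs]
    field_simp
  have hchord : (M - m) * s ^ (n + 1 + 1) ≤
      (M ^ (n + 1 + 1) - m ^ (n + 1 + 1)) * s - b := by
    have h1 := mul_le_mul_of_nonneg_left (htan hs0.le hm.le) (sub_nonneg.2 hsM)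
    have h2 := mul_le_mul_of_nonneg_left (htan hs0.le hM0.le) (sub_nonneg.2 hms)
    rw [hb]
    linear_combination h1 + h2
  have harg : 1 / s ≤ ((n + 1) * (M ^ (n + 1 + 1) - m ^ (n + 1 + 1))) / ((n + 1 + 1) * b) := by
    rw [div_le_div_iff₀ hs0 (by rw [hbs]; positivity)]
    have h := mul_le_mul_of_nonneg_left hchord hn.le
    linear_combination h + hbs
  calc (1 : ℝ) = s ^ (n + 1 + 1) * (1 / s) ^ (n + 1 + 1) := by
        rw [← mul_pow, mul_one_div_cancel hs0.ne', one_pow]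
    _ ≤ _ := by
        rw [← hs]
        gcongr

section Operators

variable {H K : Type*} [NormedAddCommGroup H] [InnerProductSpace ℂ H] [CompleteSpace H]
  [NormedAddCommGroup K] [InnerProductSpace ℂ K] [CompleteSpace K]

theorem adjoint_comp_comp_mono (V : K →L[ℂ] H) {X Y : H →L[ℂ] H} (h : X ≤ Y) :
    (adjoint V) ∘L X ∘L V ≤ (adjoint V) ∘L Y ∘L V := by
  rw [ContinuousLinearMap.le_def] at h ⊢
  simpa [ContinuousLinearMap.comp_sub, ContinuousLinearMap.sub_comp] using h.adjoint_conj V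

theorem sum_smul_adjoint_comp_comp_mono (V : K →L[ℂ] H) {ι : Type*} [Fintype ι] {w : ι → ℝ}
    (hw : ∀ j, 0 ≤ w j) {X Y : ι → H →L[ℂ] H} (h : ∀ j, X j ≤ Y j) :
    ∑ j, w j • ((adjoint V) ∘L X j ∘L V) ≤ ∑ j, w j • ((adjoint V) ∘L Y j ∘L V) :=
  Finset.sum_le_sum fun j _ =>
    smul_le_smul_of_nonneg_left (adjoint_comp_comp_mono V (h j)) (hw j)

theorem sum_smul_adjoint_comp_algebraMap_comp {V : K →L[ℂ] H} (hV : (adjoint V) ∘L V = 1)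
    {ι : Type*} [Fintype ι] {w : ι → ℝ} (hw1 : ∑ j, w j = 1) (t : ℝ) :
    ∑ j, w j • ((adjoint V) ∘L (algebraMap ℝ (H →L[ℂ] H) t) ∘L V) =
      algebraMap ℝ (K →L[ℂ] K) t := by
  have h : (adjoint V) ∘L (algebraMap ℝ (H →L[ℂ] H) t) ∘L V = algebraMap ℝ (K →L[ℂ] K) t := by
    rw [Algebra.algebraMap_eq_smul_one, Algebra.algebraMap_eq_smul_one, ← hV]
    ext x
    simp
  rw [h, ← Finset.sum_smul, hw1, one_smul]

theorem isSelfAdjoint_sum_smul_adjoint_comp_cfc_comp (V : K →L[ℂ] H) {ι : Type*} [Fintype ι]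
    (w : ι → ℝ) (q : ι → ℝ → ℝ) (A : ι → H →L[ℂ] H) :
    IsSelfAdjoint (∑ j, w j • ((adjoint V) ∘L (cfc (q j) (A j)) ∘L V)) := by
  refine isSelfAdjoint_sum _ fun j _ => IsSelfAdjoint.smul (IsSelfAdjoint.all _) ?_
  exact (cfc_predicate (q j) (A j)).adjoint_conj V

theorem spectrum_sum_smul_adjoint_comp_cfc_comp_subset {V : K →L[ℂ] H}
    (hV : (adjoint V) ∘L V = 1) {ι : Type*} [Fintype ι] {w : ι → ℝ} (hw : ∀ j, 0 ≤ w j)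
    (hw1 : ∑ j, w j = 1) {A : ι → H →L[ℂ] H} (hA : ∀ j, IsSelfAdjoint (A j))
    {q : ι → ℝ → ℝ} (hq : ∀ j, ContinuousOn (q j) (spectrum ℝ (A j))) {s t : ℝ}
    (hst : ∀ j, ∀ x ∈ spectrum ℝ (A j), q j x ∈ Set.Icc s t) :
    spectrum ℝ (∑ j, w j • ((adjoint V) ∘L (cfc (q j) (A j)) ∘L V)) ⊆ Set.Icc s t := by
  have hB := isSelfAdjoint_sum_smul_adjoint_comp_cfc_comp V w q A
  have hs := sum_smul_adjoint_comp_comp_mono V hw fun j =>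
    algebraMap_le_cfc (q j) s (A j) (fun x hx => (hst j x hx).1) (hq j) (hA j)
  have ht := sum_smul_adjoint_comp_comp_mono V hw fun j =>
    cfc_le_algebraMap (q j) t (A j) (fun x hx => (hst j x hx).2) (hq j) (hA j)
  rw [sum_smul_adjoint_comp_algebraMap_comp hV hw1] at hs ht
  intro x hx
  exact ⟨(algebraMap_le_iff_le_spectrum hB).1 hs x hx,
    (le_algebraMap_iff_spectrum_le hB).1 ht x hx⟩

theorem cfc_sum_smul_pow {A : H →L[ℂ] H} (hA : IsSelfAdjoint A) {f : ℝ → ℝ}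
    (hf : ContinuousOn f (spectrum ℝ A)) (a : ℕ → ℝ) (s : Finset ℕ) :
    cfc (fun x => ∑ i ∈ s, a i * f x ^ i) A = ∑ i ∈ s, a i • (cfc f A) ^ i := by
  have h : (fun x => ∑ i ∈ s, a i * f x ^ i) = ∑ i ∈ s, fun x => a i • f x ^ i := by
    ext x
    simp
  rw [h, cfc_sum (fun i x => a i • f x ^ i) A s fun i _ => (hf.pow i).const_smul (a i)]
  refine Finset.sum_congr rfl fun i _ => ?_
  rw [cfc_smul (a i) (fun x => f x ^ i) A (hf.pow i), cfc_pow f i A hf hA]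

theorem le_smul_cfc_exp {B : K →L[ℂ] K} (hB : IsSelfAdjoint B) {c : ℝ}
    (h : ∀ x ∈ spectrum ℝ B, x * Real.exp (-x) ≤ c) : B ≤ c • cfc Real.exp B := by
  rw [← cfc_smul c Real.exp B (by fun_prop)]
  nth_rewrite 1 [← cfc_id' ℝ B hB]
  refine cfc_mono (fun x hx => ?_) (by fun_prop) (by fun_prop)
  have h1 := h x hx
  rwa [Real.exp_neg, ← div_eq_mul_inv, div_le_iff₀ (Real.exp_pos x)] at h1

theorem smul_cfc_exp_le {B : K →L[ℂ] K} (hB : IsSelfAdjoint B) {c : ℝ}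
    (h : ∀ x ∈ spectrum ℝ B, c ≤ x * Real.exp (-x)) : c • cfc Real.exp B ≤ B := by
  rw [← cfc_smul c Real.exp B (by fun_prop)]
  nth_rewrite 2 [← cfc_id' ℝ B hB]
  refine cfc_mono (fun x hx => ?_) (by fun_prop) (by fun_prop)
  have h1 := h x hx
  rwa [Real.exp_neg, ← div_eq_mul_inv, le_div_iff₀ (Real.exp_pos x)] at h1

/-- The weighted compression of functional calculi has its spectrum in the closed convex hull of
the ranges, and that hull is compact. -/
theorem spectrum_subset_closure_convexHull {V : K →L[ℂ] H}
    (hV : (adjoint V) ∘L V = 1) {ι : Type*} [Fintype ι] [Nonempty ι] {w : ι → ℝ}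
    (hw : ∀ j, 0 ≤ w j) (hw1 : ∑ j, w j = 1) {A : ι → H →L[ℂ] H}
    (hA : ∀ j, IsSelfAdjoint (A j)) {m M : ι → ℝ} (hmM : ∀ j, m j < M j)
    (hspec : ∀ j, spectrum ℝ (A j) ⊆ Set.Icc (m j) (M j))
    {q : ι → ℝ → ℝ} (hq : ∀ j, Continuous (q j)) :
    IsCompact (closure (convexHull ℝ (⋃ j, q j '' Set.Icc (m j) (M j)))) ∧
    spectrum ℝ (∑ j, w j • ((adjoint V) ∘L (cfc (q j) (A j)) ∘L V)) ⊆
      closure (convexHull ℝ (⋃ j, q j '' Set.Icc (m j) (M j))) := by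
  set T := ⋃ j, q j '' Set.Icc (m j) (M j) with hT
  have hTc : IsCompact T := isCompact_iUnion fun j => isCompact_Icc.image (hq j)
  have hTn : T.Nonempty := by
    obtain ⟨j⟩ := ‹Nonempty ι›
    exact ⟨q j (m j), Set.mem_iUnion.2 ⟨j, m j, ⟨le_rfl, (hmM j).le⟩, rfl⟩⟩
  have hmem : ∀ j, ∀ x ∈ spectrum ℝ (A j), q j x ∈ Set.Icc (sInf T) (sSup T) := fun j x hx =>
    have hxT : q j x ∈ T := Set.mem_iUnion.2 ⟨j, x, hspec j hx, rfl⟩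
    ⟨csInf_le hTc.bddBelow hxT, le_csSup hTc.bddAbove hxT⟩
  refine ⟨?_, (spectrum_sum_smul_adjoint_comp_cfc_comp_subset hV hw hw1 hA
    (fun j => (hq j).continuousOn) hmem).trans ?_⟩
  · refine isCompact_Icc.of_isClosed_subset isClosed_closure
      (closure_minimal (convexHull_min (t := Set.Icc (sInf T) (sSup T)) ?_ (convex_Icc _ _))
        isClosed_Icc)
    exact fun x hx => ⟨csInf_le hTc.bddBelow hx, le_csSup hTc.bddAbove hx⟩
  · exact ((convex_convexHull ℝ T).ordConnected.out
      (subset_convexHull ℝ T (hTc.sInf_mem hTn)) (subset_convexHull ℝ T (hTc.sSup_mem hTn))).trans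
      subset_closure

end Operators

theorem Polynomial.sInf_image_Icc_pos {p : Polynomial ℝ} {m M : ℝ} (hmM : m < M)
    (hp : ∀ x ∈ Set.Icc m M, 0 < p.eval x) : 0 < sInf ((fun x => p.eval x) '' Set.Icc m M) := by
  obtain ⟨x, hx, h⟩ := (isCompact_Icc.image (p.continuous)).sInf_mem
    ((Set.nonempty_Icc.2 hmM.le).image _)
  rw [← h]
  exact hp x hx

/-- Termwise comparison of polynomial values, splitting the coefficients by sign: the positive part
is bounded using inflated upper powers, the negative part using deflated lower powers. -/
theorem sum_mul_pow_le_sum_filter_add_sum_filter {s : Finset ℕ} {a c d : ℕ → ℝ} {l y u : ℝ}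
    (hl : 0 < l) (hly : l ≤ y) (hyu : y ≤ u) (hc : ∀ i, 1 ≤ c i) (hd : ∀ i, 1 ≤ d i) :
    ∑ i ∈ s, a i * y ^ i ≤
      (∑ i ∈ s.filter (fun i => 0 ≤ a i), a i * c i * u ^ i) +
        ∑ i ∈ s.filter (fun i => a i < 0), a i * (d i)⁻¹ * l ^ i := by
  have hy : 0 < y := hl.trans_le hly
  rw [← Finset.sum_filter_add_sum_filter_not s (fun i => 0 ≤ a i)]
  simp only [not_le]
  refine add_le_add (Finset.sum_le_sum fun i hi => ?_) (Finset.sum_le_sum fun i hi => ?_)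
  · rw [mul_assoc]
    refine mul_le_mul_of_nonneg_left ?_ (Finset.mem_filter.1 hi).2
    calc y ^ i ≤ u ^ i := pow_le_pow_left₀ hy.le hyu i
      _ ≤ c i * u ^ i := le_mul_of_one_le_left (pow_nonneg (hy.le.trans hyu) i) (hc i)
  · rw [mul_assoc]
    refine mul_le_mul_of_nonpos_left ?_ (Finset.mem_filter.1 hi).2.le
    calc (d i)⁻¹ * l ^ i ≤ l ^ i :=
          mul_le_of_le_one_left (pow_nonneg hl.le i) (inv_le_one_of_one_le₀ (hd i))
      _ ≤ y ^ i := pow_le_pow_left₀ hl.le hly i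

theorem sum_filter_add_sum_filter_le_sum_mul_pow {s : Finset ℕ} {a c d : ℕ → ℝ} {l y u : ℝ}
    (hl : 0 < l) (hly : l ≤ y) (hyu : y ≤ u) (hc : ∀ i, 1 ≤ c i) (hd : ∀ i, 1 ≤ d i) :
    (∑ i ∈ s.filter (fun i => 0 ≤ a i), a i * (d i)⁻¹ * l ^ i) +
        ∑ i ∈ s.filter (fun i => a i < 0), a i * c i * u ^ i ≤ ∑ i ∈ s, a i * y ^ i := by
  have hy : 0 < y := hl.trans_le hly
  rw [← Finset.sum_filter_add_sum_filter_not s (fun i => 0 ≤ a i) (fun i => a i * y ^ i)]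
  simp only [not_le]
  refine add_le_add (Finset.sum_le_sum fun i hi => ?_) (Finset.sum_le_sum fun i hi => ?_)
  · rw [mul_assoc]
    refine mul_le_mul_of_nonneg_left ?_ (Finset.mem_filter.1 hi).2
    calc (d i)⁻¹ * l ^ i ≤ l ^ i :=
          mul_le_of_le_one_left (pow_nonneg hl.le i) (inv_le_one_of_one_le₀ (hd i))
      _ ≤ y ^ i := pow_le_pow_left₀ hl.le hly i
  · rw [mul_assoc]
    refine mul_le_mul_of_nonpos_left ?_ (Finset.mem_filter.1 hi).2.le
    calc y ^ i ≤ u ^ i := pow_le_pow_left₀ hy.le hyu i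
      _ ≤ c i * u ^ i := le_mul_of_one_le_left (pow_nonneg (hy.le.trans hyu) i) (hc i)

theorem stmt13
    {H K : Type*} [NormedAddCommGroup H] [InnerProductSpace ℂ H] [CompleteSpace H]
    [NormedAddCommGroup K] [InnerProductSpace ℂ K] [CompleteSpace K]
    (V : K →L[ℂ] H) (hV : (adjoint V) ∘L V = 1)
    (I : ℕ) (a : ℕ → ℝ)
    (k : ℕ) (hk : 1 ≤ k)
    (w : Fin k → ℝ) (hw : ∀ j, 0 ≤ w j) (hw1 : ∑ j, w j = 1)
    (m M : Fin k → ℝ) (hmM : ∀ j, m j < M j)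
    (A : Fin k → H →L[ℂ] H) (hA : ∀ j, IsSelfAdjoint (A j))
    (hspec : ∀ j, spectrum ℝ (A j) ⊆ Set.Icc (m j) (M j))
    (f : ℝ → ℝ) (hf : ContinuousOn f (⋃ j, Set.Icc (m j) (M j)))
    (pL pU : Polynomial ℝ)
    (hp : ∀ x ∈ ⋃ j, Set.Icc (m j) (M j),
      0 < pL.eval x ∧ pL.eval x ≤ f x ∧ f x ≤ pU.eval x)
    (mU MU mL ML : Fin k → ℝ)
    (hmU : ∀ j, mU j = sInf ((fun x => pU.eval x) '' Set.Icc (m j) (M j)))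
    (hMU : ∀ j, MU j = sSup ((fun x => pU.eval x) '' Set.Icc (m j) (M j)))
    (hmL : ∀ j, mL j = sInf ((fun x => pL.eval x) '' Set.Icc (m j) (M j)))
    (hML : ∀ j, ML j = sSup ((fun x => pL.eval x) '' Set.Icc (m j) (M j)))
    (hUlt : ∀ j, mU j < MU j) (hLlt : ∀ j, mL j < ML j)
    (qU qL : Fin k → ℝ → ℝ)
    (hqU : ∀ j x, qU j x =
      (∑ i ∈ (Finset.range (I + 1)).filter (fun i => 0 ≤ a i),
        a i * kantorovich (mU j) (MU j) (i : ℝ) * (pU.eval x) ^ i) +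
      ∑ i ∈ (Finset.range (I + 1)).filter (fun i => a i < 0),
        a i * (kantorovich (mL j) (ML j) (i : ℝ))⁻¹ * (pL.eval x) ^ i)
    (hqL : ∀ j x, qL j x =
      (∑ i ∈ (Finset.range (I + 1)).filter (fun i => 0 ≤ a i),
        a i * (kantorovich (mL j) (ML j) (i : ℝ))⁻¹ * (pL.eval x) ^ i) +
      ∑ i ∈ (Finset.range (I + 1)).filter (fun i => a i < 0),
        a i * kantorovich (mU j) (MU j) (i : ℝ) * (pU.eval x) ^ i)
    (BU BL : K →L[ℂ] K)
    (hBU : BU = ∑ j, w j • ((adjoint V) ∘L (cfc (qU j) (A j)) ∘L V))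
    (hBL : BL = ∑ j, w j • ((adjoint V) ∘L (cfc (qL j) (A j)) ∘L V))
    (SU SL : Set ℝ)
    (hSU : SU = closure (convexHull ℝ (⋃ j, qU j '' Set.Icc (m j) (M j))))
    (hSL : SL = closure (convexHull ℝ (⋃ j, qL j '' Set.Icc (m j) (M j)))) :
    ((∑ j, w j • ((adjoint V) ∘L (∑ i ∈ Finset.range (I + 1), a i • (cfc f (A j)) ^ i) ∘L V)) ≤
      (sSup ((fun x => x * Real.exp (-x)) '' SU)) • cfc Real.exp BU) ∧
    (sInf ((fun x => x * Real.exp (-x)) '' SL)) • cfc Real.exp BL ≤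
      (∑ j, w j • ((adjoint V) ∘L (∑ i ∈ Finset.range (I + 1), a i • (cfc f (A j)) ^ i) ∘L V)) := by
  have hmem : ∀ j, ∀ x ∈ Set.Icc (m j) (M j), x ∈ ⋃ j, Set.Icc (m j) (M j) :=
    fun j x hx => Set.mem_iUnion.2 ⟨j, hx⟩
  have hKU : ∀ j (i : ℕ), 1 ≤ kantorovich (mU j) (MU j) i := fun j i =>
    one_le_kantorovich (hmU j ▸ Polynomial.sInf_image_Icc_pos (hmM j) fun x hx =>
      (hp x (hmem j x hx)).1.trans_le ((hp x (hmem j x hx)).2.1.trans (hp x (hmem j x hx)).2.2))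
      (hUlt j) i
  have hKL : ∀ j (i : ℕ), 1 ≤ kantorovich (mL j) (ML j) i := fun j i =>
    one_le_kantorovich (hmL j ▸ Polynomial.sInf_image_Icc_pos (hmM j) fun x hx =>
      (hp x (hmem j x hx)).1) (hLlt j) i
  have hfc : ∀ j, ContinuousOn f (spectrum ℝ (A j)) := fun j =>
    hf.mono ((hspec j).trans (Set.subset_iUnion (fun j => Set.Icc (m j) (M j)) j))
  have hsumc : ∀ j, ContinuousOn (fun x => ∑ i ∈ Finset.range (I + 1), a i * f x ^ i)
      (spectrum ℝ (A j)) := fun j =>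
    continuousOn_finsetSum _ fun i _ => ((hfc j).pow i).const_mul (a i)
  have hqUc : ∀ j, Continuous (qU j) := fun j => by
    rw [funext (hqU j)]
    fun_prop
  have hqLc : ∀ j, Continuous (qL j) := fun j => by
    rw [funext (hqL j)]
    fun_prop
  have : Nonempty (Fin k) := ⟨⟨0, hk⟩⟩
  obtain ⟨hSUc, hSU'⟩ :=
    spectrum_subset_closure_convexHull hV hw hw1 hA hmM hspec hqUc
  obtain ⟨hSLc, hSL'⟩ :=
    spectrum_subset_closure_convexHull hV hw hw1 hA hmM hspec hqLc
  rw [← hBU, ← hSU] at hSU'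
  rw [← hBL, ← hSL] at hSL'
  rw [← hSU] at hSUc
  rw [← hSL] at hSLc
  have hg : Continuous fun x : ℝ => x * Real.exp (-x) := by fun_prop
  have hBUs : IsSelfAdjoint BU :=
    hBU ▸ isSelfAdjoint_sum_smul_adjoint_comp_cfc_comp V w qU A
  have hBLs : IsSelfAdjoint BL :=
    hBL ▸ isSelfAdjoint_sum_smul_adjoint_comp_cfc_comp V w qL A
  simp only [← fun j => cfc_sum_smul_pow (hA j) (hfc j) a (Finset.range (I + 1))]
  constructor
  · refine le_trans ?_ (le_smul_cfc_exp hBUs fun x hx =>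
      le_csSup (hSUc.image hg).bddAbove (Set.mem_image_of_mem _ (hSU' hx)))
    rw [hBU]
    refine sum_smul_adjoint_comp_comp_mono V hw fun j =>
      cfc_mono (fun x hx => ?_) (hsumc j) (hqUc j).continuousOn
    obtain ⟨h0, h1, h2⟩ := hp x (hmem j x (hspec j hx))
    rw [hqU]
    exact sum_mul_pow_le_sum_filter_add_sum_filter h0 h1 h2 (hKU j) (hKL j)
  · refine (smul_cfc_exp_le hBLs fun x hx =>
      csInf_le (hSLc.image hg).bddBelow (Set.mem_image_of_mem _ (hSL' hx))).trans ?_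
    rw [hBL]
    refine sum_smul_adjoint_comp_comp_mono V hw fun j =>
      cfc_mono (fun x hx => ?_) (hqLc j).continuousOn (hsumc j)
    obtain ⟨h0, h1, h2⟩ := hp x (hmem j x (hspec j hx))
    rw [hqL]
    exact sum_filter_add_sum_filter_le_sum_mul_pow h0 h1 h2 (hKU j) (hKL j)
end

section
/- Let m < M be reals, let A_1, …, A_k ∈ B(H) be self-adjoint with Λ(A_j) ⊆ [m, M], and let w_1, …, w_k be nonnegative reals with Σ_{j=1}^k w_j = 1. Let f and h be continuous real functions on [m, M] and a, b, b', c, d, d' reals with a·x + b' ≤ f(x) ≤ a·x + b and c·x + d' ≤ h(x) ≤ c·x + d for all x ∈ [m, M]. Let g be a continuous real function on [m, M] with g(x) > 0 for all x ∈ [m, M], and set α_{f,U} = max_{x ∈ [m,M]} (a·x + b)/g(x), α_{f,L} = min_{x ∈ [m,M]} (a·x + b')/g(x), α_{h,U} = max_{x ∈ [m,M]} (c·x + d)/g(x), α_{h,L} = min_{x ∈ [m,M]} (c·x + d')/g(x). With Ψ(X) = V* X V and B = Σ_{j=1}^k w_j Ψ(A_j), it holds that (α_{f,L} + α_{h,L})·g(B)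 ≤ Σ_{j=1}^k w_j Ψ(f(A_j)) + Σ_{j=1}^k w_j Ψ(h(A_j)) ≤ (α_{f,U} + α_{h,U})·g(B) in the Loewner order, where g(B) is defined by continuous functional calculus (note Λ(B) ⊆ [m, M]). -/
open ContinuousLinearMap Polynomial

section Compression

variable {H K : Type*} [NormedAddCommGroup H] [InnerProductSpace ℂ H] [CompleteSpace H]
  [NormedAddCommGroup K] [InnerProductSpace ℂ K] [CompleteSpace K]

theorem sum_smul_compression_mono (V : K →L[ℂ] H) {ι : Type*} [Fintype ι] {w : ι → ℝ}
    (hw : ∀ j, 0 ≤ w j) {X Y : ι → H →L[ℂ] H} (hXY : ∀ j, X j ≤ Y j) :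
    ∑ j, w j • (adjoint V ∘L X j ∘L V) ≤ ∑ j, w j • (adjoint V ∘L Y j ∘L V) := by
  refine Finset.sum_le_sum fun j _ => smul_le_smul_of_nonneg_left ?_ (hw j)
  rw [ContinuousLinearMap.le_def]
  have hpos := ((ContinuousLinearMap.le_def _ _).1 (hXY j)).adjoint_conj V
  simpa only [ContinuousLinearMap.sub_comp, ContinuousLinearMap.comp_sub] using hpos

theorem sum_smul_compression_affine {V : K →L[ℂ] H} (hV : adjoint V ∘L V = 1)
    {ι : Type*} [Fintype ι] {w : ι → ℝ} (hw1 : ∑ j, w j = 1) (A : ι → H →L[ℂ] H) (p q : ℝ) :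
    ∑ j, w j • (adjoint V ∘L (p • A j + algebraMap ℝ (H →L[ℂ] H) q) ∘L V) =
      p • (∑ j, w j • (adjoint V ∘L A j ∘L V)) + algebraMap ℝ (K →L[ℂ] K) q := by
  have hterm (j : ι) : adjoint V ∘L (p • A j + algebraMap ℝ (H →L[ℂ] H) q) ∘L V =
      p • (adjoint V ∘L A j ∘L V) + algebraMap ℝ (K →L[ℂ] K) q := by
    have h1 : (1 : H →L[ℂ] H) ∘L V = V := ContinuousLinearMap.id_comp V
    simp only [Algebra.algebraMap_eq_smul_one, ContinuousLinearMap.add_comp,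
      ContinuousLinearMap.smul_comp, ContinuousLinearMap.comp_add,
      ContinuousLinearMap.comp_smul, h1, hV]
  simp only [hterm, smul_add, Finset.sum_add_distrib, ← Finset.sum_smul, hw1, one_smul,
    Finset.smul_sum]
  congr 1
  exact Finset.sum_congr rfl fun j _ => smul_comm _ _ _

theorem isSelfAdjoint_sum_smul_compression (V : K →L[ℂ] H) {ι : Type*} [Fintype ι] (w : ι → ℝ)
    {A : ι → H →L[ℂ] H} (hA : ∀ j, IsSelfAdjoint (A j)) :
    IsSelfAdjoint (∑ j, w j • (adjoint V ∘L A j ∘L V)) :=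
  isSelfAdjoint_sum _ fun j _ => (IsSelfAdjoint.all (w j)).smul ((hA j).adjoint_conj V)

theorem cfc_affine {A : H →L[ℂ] H} (hA : IsSelfAdjoint A) (p q : ℝ) :
    cfc (fun x : ℝ => p * x + q) A = p • A + algebraMap ℝ (H →L[ℂ] H) q := by
  rw [cfc_add_const q (fun x : ℝ => p * x) A, cfc_const_mul_id p A]

variable {V : K →L[ℂ] H} {ι : Type*} [Fintype ι] {w : ι → ℝ} {A : ι → H →L[ℂ] H} {m M : ℝ}

theorem spectrum_sum_smul_compression_subset (hV : adjoint V ∘L V = 1) (hw : ∀ j, 0 ≤ w j)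
    (hw1 : ∑ j, w j = 1) (hA : ∀ j, IsSelfAdjoint (A j))
    (hspec : ∀ j, spectrum ℝ (A j) ⊆ Set.Icc m M) :
    spectrum ℝ (∑ j, w j • (adjoint V ∘L A j ∘L V)) ⊆ Set.Icc m M := by
  have hB := isSelfAdjoint_sum_smul_compression V w hA
  have hconst (q : ℝ) : ∑ j, w j • (adjoint V ∘L algebraMap ℝ (H →L[ℂ] H) q ∘L V) =
      algebraMap ℝ (K →L[ℂ] K) q := by
    simpa using sum_smul_compression_affine hV hw1 A 0 q
  have hl := sum_smul_compression_mono V hw fun j =>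
    (algebraMap_le_iff_le_spectrum (hA j)).2 fun x hx => (hspec j hx).1
  have hu := sum_smul_compression_mono V hw fun j =>
    (le_algebraMap_iff_spectrum_le (hA j)).2 fun x hx => (hspec j hx).2
  rw [hconst] at hl hu
  exact fun x hx => ⟨(algebraMap_le_iff_le_spectrum hB).1 hl x hx,
    (le_algebraMap_iff_spectrum_le hB).1 hu x hx⟩

theorem sum_smul_compression_cfc_le {f g : ℝ → ℝ} {p q α : ℝ} (hV : adjoint V ∘L V = 1)
    (hw : ∀ j, 0 ≤ w j) (hw1 : ∑ j, w j = 1) (hA : ∀ j, IsSelfAdjoint (A j))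
    (hspec : ∀ j, spectrum ℝ (A j) ⊆ Set.Icc m M)
    (hf : ContinuousOn f (Set.Icc m M)) (hg : ContinuousOn g (Set.Icc m M))
    (hfp : ∀ x ∈ Set.Icc m M, f x ≤ p * x + q)
    (hpg : ∀ x ∈ Set.Icc m M, p * x + q ≤ α * g x) :
    ∑ j, w j • (adjoint V ∘L cfc f (A j) ∘L V) ≤
      α • cfc g (∑ j, w j • (adjoint V ∘L A j ∘L V)) := by
  have hB := isSelfAdjoint_sum_smul_compression V w hA
  have hsB := spectrum_sum_smul_compression_subset hV hw hw1 hA hspec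
  calc ∑ j, w j • (adjoint V ∘L cfc f (A j) ∘L V)
      ≤ ∑ j, w j • (adjoint V ∘L cfc (fun x : ℝ => p * x + q) (A j) ∘L V) :=
        sum_smul_compression_mono V hw fun j =>
          cfc_mono (fun x hx => hfp x (hspec j hx)) (hf.mono (hspec j)) (by fun_prop)
    _ = cfc (fun x : ℝ => p * x + q) (∑ j, w j • (adjoint V ∘L A j ∘L V)) := by
        simp only [cfc_affine (hA _), cfc_affine hB, sum_smul_compression_affine hV hw1]
    _ ≤ cfc (fun x => α * g x) (∑ j, w j • (adjoint V ∘L A j ∘L V)) :=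
        cfc_mono (fun x hx => hpg x (hsB hx)) (by fun_prop) ((hg.mono hsB).const_mul α)
    _ = α • cfc g (∑ j, w j • (adjoint V ∘L A j ∘L V)) := cfc_const_mul α g _ (hg.mono hsB)

theorem le_sum_smul_compression_cfc {f g : ℝ → ℝ} {p q α : ℝ} (hV : adjoint V ∘L V = 1)
    (hw : ∀ j, 0 ≤ w j) (hw1 : ∑ j, w j = 1) (hA : ∀ j, IsSelfAdjoint (A j))
    (hspec : ∀ j, spectrum ℝ (A j) ⊆ Set.Icc m M)
    (hf : ContinuousOn f (Set.Icc m M)) (hg : ContinuousOn g (Set.Icc m M))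
    (hpf : ∀ x ∈ Set.Icc m M, p * x + q ≤ f x)
    (hgp : ∀ x ∈ Set.Icc m M, α * g x ≤ p * x + q) :
    α • cfc g (∑ j, w j • (adjoint V ∘L A j ∘L V)) ≤
      ∑ j, w j • (adjoint V ∘L cfc f (A j) ∘L V) := by
  have hneg := sum_smul_compression_cfc_le (f := fun x => -f x) (p := -p) (q := -q) (α := -α)
    hV hw hw1 hA hspec hf.neg hg (fun x hx => by linarith [hpf x hx])
    (fun x hx => by linarith [hgp x hx])
  simpa only [cfc_neg, ContinuousLinearMap.neg_comp, ContinuousLinearMap.comp_neg, smul_neg,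
    Finset.sum_neg_distrib, neg_smul, neg_le_neg_iff] using hneg

end Compression

section Ratio

variable {s : Set ℝ} {l g : ℝ → ℝ}

theorem le_sSup_div_mul (hs : IsCompact s) (hl : ContinuousOn l s) (hg : ContinuousOn g s)
    (hpos : ∀ x ∈ s, 0 < g x) {x : ℝ} (hx : x ∈ s) :
    l x ≤ sSup ((fun x => l x / g x) '' s) * g x :=
  (div_le_iff₀ (hpos x hx)).1 <|
    le_csSup (hs.bddAbove_image (hl.div hg fun y hy => (hpos y hy).ne'))
      (Set.mem_image_of_mem (fun x => l x / g x) hx)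

theorem sInf_div_mul_le (hs : IsCompact s) (hl : ContinuousOn l s) (hg : ContinuousOn g s)
    (hpos : ∀ x ∈ s, 0 < g x) {x : ℝ} (hx : x ∈ s) :
    sInf ((fun x => l x / g x) '' s) * g x ≤ l x :=
  (le_div_iff₀ (hpos x hx)).1 <|
    csInf_le (hs.bddBelow_image (hl.div hg fun y hy => (hpos y hy).ne'))
      (Set.mem_image_of_mem (fun x => l x / g x) hx)

end Ratio

theorem stmt19
    {H K : Type*} [NormedAddCommGroup H] [InnerProductSpace ℂ H] [CompleteSpace H]
    [NormedAddCommGroup K] [InnerProductSpace ℂ K] [CompleteSpace K]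
    (V : K →L[ℂ] H) (hV : (adjoint V) ∘L V = 1)
    (m M : ℝ) (hmM : m < M)
    (k : ℕ) (hk : 1 ≤ k)
    (w : Fin k → ℝ) (hw : ∀ j, 0 ≤ w j) (hw1 : ∑ j, w j = 1)
    (A : Fin k → H →L[ℂ] H) (hA : ∀ j, IsSelfAdjoint (A j))
    (hspec : ∀ j, spectrum ℝ (A j) ⊆ Set.Icc m M)
    (f h : ℝ → ℝ) (hf : ContinuousOn f (Set.Icc m M)) (hh : ContinuousOn h (Set.Icc m M))
    (a b b' c d d' : ℝ)
    (hfbd : ∀ x ∈ Set.Icc m M, a * x + b' ≤ f x ∧ f x ≤ a * x + b)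
    (hhbd : ∀ x ∈ Set.Icc m M, c * x + d' ≤ h x ∧ h x ≤ c * x + d)
    (g : ℝ → ℝ) (hg : ContinuousOn g (Set.Icc m M)) (hgpos : ∀ x ∈ Set.Icc m M, 0 < g x)
    (αfU αfL αhU αhL : ℝ)
    (hαfU : αfU = sSup ((fun x => (a * x + b) / g x) '' Set.Icc m M))
    (hαfL : αfL = sInf ((fun x => (a * x + b') / g x) '' Set.Icc m M))
    (hαhU : αhU = sSup ((fun x => (c * x + d) / g x) '' Set.Icc m M))
    (hαhL : αhL = sInf ((fun x => (c * x + d') / g x) '' Set.Icc m M))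
    (B : K →L[ℂ] K) (hB : B = ∑ j, w j • ((adjoint V) ∘L (A j) ∘L V)) :
    ((αfL + αhL) • cfc g B ≤
      (∑ j, w j • ((adjoint V) ∘L (cfc f (A j)) ∘L V)) + (∑ j, w j • ((adjoint V) ∘L (cfc h (A j)) ∘L V))) ∧
    (∑ j, w j • ((adjoint V) ∘L (cfc f (A j)) ∘L V)) + (∑ j, w j • ((adjoint V) ∘L (cfc h (A j)) ∘L V)) ≤
      (αfU + αhU) • cfc g B := by
  subst hB hαfU hαfL hαhU hαhL
  have hU (p q : ℝ) := fun x hx => le_sSup_div_mul (l := fun x => p * x + q) (x := x)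
    isCompact_Icc (by fun_prop) hg hgpos hx
  have hL (p q : ℝ) := fun x hx => sInf_div_mul_le (l := fun x => p * x + q) (x := x)
    isCompact_Icc (by fun_prop) hg hgpos hx
  rw [add_smul, add_smul]
  exact ⟨add_le_add
      (le_sum_smul_compression_cfc hV hw hw1 hA hspec hf hg (fun x hx => (hfbd x hx).1) (hL a b'))
      (le_sum_smul_compression_cfc hV hw hw1 hA hspec hh hg (fun x hx => (hhbd x hx).1) (hL c d')),
    add_le_add
      (sum_smul_compression_cfc_le hV hw hw1 hA hspec hf hg (fun x hx => (hfbd x hx).2) (hU a b))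
      (sum_smul_compression_cfc_le hV hw hw1 hA hspec hh hg (fun x hx => (hhbd x hx).2) (hU c d))⟩
end
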